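/- arXiv:2009.08562 — 2 statements merged into one kernel-verified Lean document; each statement's English description precedes it below -/
import Mathlib

section
/- For all fixed reals γ > 0 and κ > 0: lim_{m→∞} m · D(γ/m ‖ κ/m) = ( κ − γ + γ·ln(γ/κ) ) / ln 2, where D is the binary relative entropy in bits (the expression is well defined for all m large enough that γ/m, κ/m ∈ (0,1)). -/
/-!
STATEMENT 11: For all fixed reals γ > 0 and κ > 0:
lim_{m→∞} m·D(γ/m ‖ κ/m) = (κ − γ + γ·ln(γ/κ)) / ln 2.
-/

/-- Binary relative entropy in bits (real-valued formula, well defined for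
arguments in `(0,1)`). -/
noncomputable def binDR (p q : ℝ) : ℝ :=
  p * Real.logb 2 (p / q) + (1 - p) * Real.logb 2 ((1 - p) / (1 - q))

theorem poisson_regime_limit (γ κ : ℝ) (hγ : 0 < γ) (hκ : 0 < κ) :
    Filter.Tendsto (fun m : ℕ => (m : ℝ) * binDR (γ / (m : ℝ)) (κ / (m : ℝ)))
      Filter.atTop (nhds ((κ - γ + γ * Real.log (γ / κ)) / Real.log 2)) := by
  have hlog (t : ℝ) :
      Filter.Tendsto (fun m : ℕ => (m : ℝ) * Real.log (1 + -t / (m : ℝ)))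
        Filter.atTop (nhds (-t)) :=
    (Real.tendsto_mul_log_one_add_div_atTop (-t)).comp tendsto_natCast_atTop_atTop
  have hpos (t : ℝ) : ∀ᶠ m : ℕ in Filter.atTop, 0 < 1 + -t / (m : ℝ) := by
    have h := (tendsto_const_div_atTop_nhds_zero_nat (-t)).const_add 1
    exact h.eventually_const_lt (by norm_num)
  have hlim := (((((tendsto_const_div_atTop_nhds_zero_nat (-γ)).const_add 1).mul
    ((hlog γ).sub (hlog κ))).add_const (γ * Real.log (γ / κ))).div_const (Real.log 2))
  have hval : (1 + 0) * (-γ - -κ) + γ * Real.log (γ / κ) =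
      κ - γ + γ * Real.log (γ / κ) := by ring
  rw [hval] at hlim
  refine hlim.congr' ?_
  filter_upwards [hpos γ, hpos κ, Filter.eventually_ne_atTop 0] with m hm₁ hm₂ hm
  have hm' : (m : ℝ) ≠ 0 := Nat.cast_ne_zero.mpr hm
  have hneg (t : ℝ) : 1 - t / (m : ℝ) = 1 + -t / (m : ℝ) := by ring
  rw [binDR, div_div_div_cancel_right₀ hm', hneg, hneg, Real.logb, Real.logb,
    Real.log_div hm₁.ne' hm₂.ne']
  generalize Real.log (1 + -γ / (m : ℝ)) = a
  generalize Real.log (1 + -κ / (m : ℝ)) = b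
  field_simp
  ring
end

section
/- Let d(x,y) = y − x + x·ln(x/y) for x, y > 0, and fix α ∈ ℝ. For every γ > 0 there is a unique κ = κ(γ) with κ − α > γ and d(κ − α, γ) = 1/2, and along this upper branch lim_{γ→∞} d(γ, κ(γ)) = lim_{γ→∞} [ κ(γ) − γ + γ·ln(γ/κ(γ)) ] = 1/2. -/
/-!
STATEMENT 15: Let d(x,y) = y − x + x·ln(x/y) for x,y > 0, and fix α ∈ ℝ.  For
every γ > 0 there is a unique κ = κ(γ) with κ − α > γ and d(κ−α, γ) = 1/2, and
along this upper branch lim_{γ→∞} d(γ, κ(γ)) = 1/2.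
-/

/-- The Poisson-regime divergence `d(x,y) = y − x + x·ln(x/y)`. -/
noncomputable def dPois (x y : ℝ) : ℝ := y - x + x * Real.log (x / y)

theorem dPois_eq_mul_left {x y : ℝ} (hy : 0 < y) :
    dPois x y = y * ((1 + (x - y) / y) * Real.log (1 + (x - y) / y) - (x - y) / y) := by
  have h : 1 + (x - y) / y = x / y := by field_simp; ring
  rw [h, dPois]
  field_simp
  ring

theorem dPois_eq_mul_right {x y : ℝ} (hx : 0 < x) :
    dPois x y = x * ((y - x) / x - Real.log (1 + (y - x) / x)) := by
  have h : 1 + (y - x) / x = y / x := by field_simp; ring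
  have hlog : Real.log (x / y) = -Real.log (y / x) := by rw [← Real.log_inv, inv_div]
  rw [h, dPois, hlog]
  field_simp
  ring

theorem dPois_self {y : ℝ} (hy : 0 < y) : dPois y y = 0 := by
  simp [dPois, div_self hy.ne']

theorem hasDerivAt_dPois {x y : ℝ} (hx : 0 < x) (hy : 0 < y) :
    HasDerivAt (fun z => dPois z y) (Real.log (x / y)) x := by
  have h := (((hasDerivAt_id x).div_const y).log (div_pos hx hy).ne')
  refine (((hasDerivAt_id x).const_sub y).add ((hasDerivAt_id x).mul h)).congr_deriv ?_
  simp only [id]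
  field_simp
  ring

theorem continuousOn_dPois {y : ℝ} (hy : 0 < y) :
    ContinuousOn (fun z => dPois z y) (Set.Ici y) := fun _ hx =>
  (hasDerivAt_dPois (hy.trans_le hx) hy).continuousAt.continuousWithinAt

theorem strictMonoOn_dPois {y : ℝ} (hy : 0 < y) :
    StrictMonoOn (fun z => dPois z y) (Set.Ici y) := by
  refine strictMonoOn_of_deriv_pos (convex_Ici y) (continuousOn_dPois hy) fun x hx => ?_
  rw [interior_Ici, Set.mem_Ioi] at hx
  rw [(hasDerivAt_dPois (hy.trans hx) hy).deriv]
  exact Real.log_pos ((one_lt_div hy).2 hx)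

theorem sq_div_le_mul_log_sub {t : ℝ} (ht : 0 ≤ t) :
    t ^ 2 / (t + 2) ≤ (1 + t) * Real.log (1 + t) - t := by
  have h := mul_le_mul_of_nonneg_left (Real.le_log_one_add_of_nonneg ht)
    (by positivity : 0 ≤ 1 + t)
  have e : t ^ 2 / (t + 2) = (1 + t) * (2 * t / (t + 2)) - t := by field_simp; ring
  linarith

theorem existsUnique_dPois_eq {y c : ℝ} (hy : 0 < y) (hc : 0 < c) :
    ∃! x : ℝ, y < x ∧ dPois x y = c := by
  have hmono := strictMonoOn_dPois hy
  have hX : y ≤ 2 * y + y + 2 * c := by linarith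
  have hbig : c ≤ dPois (2 * y + y + 2 * c) y := by
    rw [dPois_eq_mul_left hy]
    have ht : (2 * y + y + 2 * c - y) / y = 2 + 2 * c / y := by field_simp; ring
    rw [ht]
    have hs : 0 < c / y := by positivity
    have h := sq_div_le_mul_log_sub (t := 2 + 2 * c / y) (by positivity)
    have h' : c / y ≤ (2 + 2 * c / y) ^ 2 / (2 + 2 * c / y + 2) := by
      rw [mul_div_assoc, le_div_iff₀ (by positivity)]
      nlinarith
    calc c = y * (c / y) := by field_simp
      _ ≤ _ := mul_le_mul_of_nonneg_left (h'.trans h) hy.le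
  obtain ⟨x, hx, hxc⟩ := intermediate_value_Icc hX
    ((continuousOn_dPois hy).mono Set.Icc_subset_Ici_self)
    ⟨(dPois_self hy).le.trans hc.le, hbig⟩
  have hne : y ≠ x := by
    rintro rfl
    exact hc.ne ((dPois_self hy).symm.trans hxc)
  refine ⟨x, ⟨lt_of_le_of_ne hx.1 hne, hxc⟩, fun z hz => ?_⟩
  exact hmono.injOn hz.1.le hx.1 (hz.2.trans hxc.symm)

theorem abs_log_one_add_sub_le {v : ℝ} (hv : |v| ≤ 1 / 2) :
    |v - Real.log (1 + v) - v ^ 2 / 2| ≤ 2 * |v| ^ 3 := by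
  have h := Real.abs_log_sub_add_sum_range_le (x := -v) (by rw [abs_neg]; linarith) 2
  rw [abs_neg] at h
  have e : v - Real.log (1 + v) - v ^ 2 / 2 =
      -((∑ i ∈ Finset.range 2, (-v) ^ (i + 1) / ((i : ℝ) + 1)) + Real.log (1 - -v)) := by
    simp [Finset.sum_range_succ]
    ring
  rw [e, abs_neg]
  refine h.trans ?_
  rw [div_le_iff₀ (by linarith)]
  calc |v| ^ (2 + 1) = 2 * |v| ^ 3 * (1 / 2) := by ring
    _ ≤ 2 * |v| ^ 3 * (1 - |v|) := by gcongr; linarith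

theorem abs_mul_log_sub_le {t : ℝ} (ht : |t| ≤ 1 / 2) :
    |(1 + t) * Real.log (1 + t) - t - t ^ 2 / 2| ≤ 4 * |t| ^ 3 := by
  have h := abs_log_one_add_sub_le ht
  have e : (1 + t) * Real.log (1 + t) - t - t ^ 2 / 2 =
      -(t ^ 3 / 2) - (1 + t) * (t - Real.log (1 + t) - t ^ 2 / 2) := by ring
  have h1 : |1 + t| ≤ 3 / 2 := (abs_add_le 1 t).trans (by rw [abs_one]; linarith)
  have h3 : 0 ≤ |t| ^ 3 := by positivity
  calc _ ≤ |-(t ^ 3 / 2)| + |(1 + t) * (t - Real.log (1 + t) - t ^ 2 / 2)| := by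
        rw [e]; exact abs_sub _ _
    _ ≤ |t| ^ 3 / 2 + 3 / 2 * (2 * |t| ^ 3) := by
        rw [abs_neg, abs_div, abs_pow, abs_two, abs_mul]
        gcongr
    _ ≤ 4 * |t| ^ 3 := by linarith

theorem mul_sq_le_two {γ u : ℝ} (hγ : 1 ≤ γ) (hu : 0 ≤ u)
    (h : γ * ((1 + u) * Real.log (1 + u) - u) = 1 / 2) : γ * u ^ 2 ≤ 2 := by
  have h1 := mul_le_mul_of_nonneg_left (sq_div_le_mul_log_sub hu) (by linarith : 0 ≤ γ)
  rw [h, ← mul_div_assoc, div_le_iff₀ (by positivity)] at h1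
  have h2 : u ≤ 2 := by nlinarith [sq_nonneg u]
  linarith

open Filter Topology in
theorem tendsto_zero_of_mul_sq_le {u : ℝ → ℝ} {C : ℝ} (h : ∀ᶠ γ in atTop, γ * u γ ^ 2 ≤ C) :
    Tendsto u atTop (𝓝 0) := by
  have hsq : Tendsto (fun γ => u γ ^ 2) atTop (𝓝 0) := by
    refine squeeze_zero' (.of_forall fun γ => sq_nonneg _) ?_
      (tendsto_const_nhds.div_atTop tendsto_id : Tendsto (fun γ : ℝ => C / γ) atTop (𝓝 0))
    filter_upwards [h, eventually_gt_atTop 0] with γ hγ hpos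
    rw [le_div_iff₀ hpos]
    linarith
  rw [tendsto_zero_iff_abs_tendsto_zero]
  simpa [Function.comp_def, Real.sqrt_sq_eq_abs] using hsq.sqrt

open Filter Topology in
/-- Along `u → 0` with `γ * u ^ 2` bounded, a cubic error term is negligible after scaling
by `γ`. -/
theorem tendsto_mul_sub_of_cubic {f u : ℝ → ℝ} {C K : ℝ} (hK : 0 ≤ K)
    (hf : ∀ t : ℝ, |t| ≤ 1 / 2 → |f t - t ^ 2 / 2| ≤ K * |t| ^ 3)
    (hC : ∀ᶠ γ in atTop, γ * u γ ^ 2 ≤ C) :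
    Tendsto (fun γ => γ * f (u γ) - γ * u γ ^ 2 / 2) atTop (𝓝 0) := by
  have hu := (tendsto_zero_iff_abs_tendsto_zero u).1 (tendsto_zero_of_mul_sq_le hC)
  have hlim : Tendsto (fun γ => K * C * |u γ|) atTop (𝓝 0) := by
    simpa using hu.const_mul (K * C)
  refine squeeze_zero_norm' ?_ hlim
  filter_upwards [hC, hu.eventually_le_const (by norm_num : (0 : ℝ) < 1 / 2),
    eventually_ge_atTop 0] with γ hγ hsmall hpos
  have e : γ * f (u γ) - γ * u γ ^ 2 / 2 = γ * (f (u γ) - u γ ^ 2 / 2) := by ring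
  rw [e, Real.norm_eq_abs, abs_mul, abs_of_nonneg hpos]
  calc γ * |f (u γ) - u γ ^ 2 / 2| ≤ γ * (K * |u γ| ^ 3) := by gcongr; exact hf _ hsmall
    _ = K * (γ * u γ ^ 2) * |u γ| := by rw [← sq_abs (u γ)]; ring
    _ ≤ K * C * |u γ| := by gcongr

theorem upper_branch_limit (α : ℝ) :
    (∀ γ : ℝ, 0 < γ → ∃! κ : ℝ, γ < κ - α ∧ dPois (κ - α) γ = 1 / 2) ∧
    ∀ κf : ℝ → ℝ, (∀ γ : ℝ, 0 < γ → γ < κf γ - α ∧ dPois (κf γ - α) γ = 1 / 2) →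
      Filter.Tendsto (fun γ : ℝ => dPois γ (κf γ)) Filter.atTop
        (nhds (1 / 2)) := by
  constructor
  · intro γ hγ
    obtain ⟨x, hx, huniq⟩ := existsUnique_dPois_eq hγ (by norm_num : (0 : ℝ) < 1 / 2)
    refine ⟨x + α, by simpa using hx, fun κ hκ => ?_⟩
    linarith [huniq _ hκ]
  · intro κf hκ
    set u : ℝ → ℝ := fun γ => (κf γ - α - γ) / γ with hu
    set v : ℝ → ℝ := fun γ => (κf γ - γ) / γ with hv
    have hbound : ∀ᶠ γ in Filter.atTop, γ * u γ ^ 2 ≤ 2 := by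
      filter_upwards [Filter.eventually_ge_atTop 1] with γ hγ
      have hpos : 0 < γ := by linarith
      obtain ⟨hlt, heq⟩ := hκ γ hpos
      rw [dPois_eq_mul_left hpos] at heq
      exact mul_sq_le_two hγ (div_nonneg (by linarith) hpos.le) heq
    have hu0 := tendsto_zero_of_mul_sq_le hbound
    have husq : Filter.Tendsto (fun γ => γ * u γ ^ 2) Filter.atTop (nhds 1) := by
      have h := (tendsto_mul_sub_of_cubic (by norm_num) (fun t => abs_mul_log_sub_le) hbound)
      have h' := (h.const_mul 2).const_sub 1
      rw [mul_zero, sub_zero] at h'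
      refine h'.congr' ?_
      filter_upwards [Filter.eventually_gt_atTop 0] with γ hγ
      have heq := (hκ γ hγ).2
      rw [dPois_eq_mul_left hγ] at heq
      rw [heq]
      ring
    have hvsq : Filter.Tendsto (fun γ => γ * v γ ^ 2) Filter.atTop (nhds 1) := by
      have hα : Filter.Tendsto (fun γ : ℝ => α ^ 2 / γ) Filter.atTop (nhds 0) :=
        tendsto_const_nhds.div_atTop Filter.tendsto_id
      have h := (husq.add (hu0.const_mul (2 * α))).add hα
      rw [mul_zero, add_zero, add_zero] at h
      refine h.congr' ?_
      filter_upwards [Filter.eventually_gt_atTop 0] with γ hγ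
      simp only [hu, hv]
      field_simp
      ring
    have h := (tendsto_mul_sub_of_cubic (by norm_num) (fun t => abs_log_one_add_sub_le)
      (hvsq.eventually_le_const (by norm_num : (1 : ℝ) < 2))).add (hvsq.div_const 2)
    rw [zero_add] at h
    refine h.congr' ?_
    filter_upwards [Filter.eventually_gt_atTop 0] with γ hγ
    rw [dPois_eq_mul_right hγ]
    ring
end
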